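/- arXiv:2405.02139 — 2 statements merged into one kernel-verified Lean document; each statement's English description precedes it below -/
import Mathlib

section
/- Under the DIRK hypotheses (lower triangular Butcher matrix with each I − h a_{kk} L invertible), every matrix R^{(k)} commutes with L, and for each k = 1,…,s the product (∏_{j=1}^{k}(I − h a_{jj} L)) · R^{(k)} equals N_k(hL) for some real polynomial N_k of degree at most k−1. Consequently (∏_{j=1}^{s}(I − h a_{jj} L)) · (I + h Σ_{i=1}^{s} b_i L R^{(i)}) is a polynomial in hL, so the amplification matrix of a DIRK method is the rational matrix function N(hL)·D(hL)^{-1} with D(z) = ∏_{j=1}^{s}(1 − a_{jj} z). -/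
open Polynomial in
theorem natDegree_prod_one_sub_C_mul_X_le {ι K : Type*} [CommRing K] (S : Finset ι) (a : ι → K) :
    (∏ j ∈ S, (1 - C (a j) * X)).natDegree ≤ S.card := by
  refine (natDegree_prod_le _ _).trans ?_
  rw [Finset.card_eq_sum_ones]
  refine Finset.sum_le_sum fun j _ => ?_
  compute_degree

open Polynomial in
/-- If each `R j`, multiplied by its own denominator, is a polynomial in `h • L`, then multiplying
`1 + ∑ j ∈ T, c j • (h • L) * R j` by a common denominator also gives a polynomial. -/
theorem exists_aeval_eq_prod_mul_stage_sum {s : ℕ} {K B : Type*} [CommRing K] [Ring B]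
    [Algebra K B] (L : B) (h : K) (a c : Fin s → K) (R : Fin s → B) (S T : Finset (Fin s))
    (hST : ∀ j ∈ T, Finset.Iic j ⊆ S)
    (hR : ∀ j ∈ T, ∃ Q : K[X], Q.natDegree ≤ (j : ℕ) ∧
      aeval (h • L) (∏ i ∈ Finset.Iic j, (1 - C (a i) * X)) * R j = aeval (h • L) Q) :
    ∃ P : K[X], P.natDegree ≤ S.card ∧
      aeval (h • L) (∏ i ∈ S, (1 - C (a i) * X)) * (1 + ∑ j ∈ T, (h * c j) • (L * R j)) =
        aeval (h • L) P := by
  choose! Q hQdeg hQ using hR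
  refine ⟨∏ i ∈ S, (1 - C (a i) * X) +
    ∑ j ∈ T, C (c j) * X * (∏ i ∈ S \ Finset.Iic j, (1 - C (a i) * X)) * Q j, ?_, ?_⟩
  · refine natDegree_add_le_of_degree_le (natDegree_prod_one_sub_C_mul_X_le S a) ?_
    refine natDegree_sum_le_of_forall_le _ _ fun j hj => ?_
    have hcard := Finset.card_sdiff_add_card_eq_card (hST j hj)
    rw [Fin.card_Iic] at hcard
    have h1 := natDegree_mul_le_of_le
      (natDegree_mul_le_of_le ((natDegree_C_mul_le (c j) X).trans natDegree_X_le)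
        (natDegree_prod_one_sub_C_mul_X_le (S \ Finset.Iic j) a)) (hQdeg j hj)
    exact h1.trans (by omega)
  · rw [mul_add, mul_one, map_add, map_sum, Finset.mul_sum]
    congr 1
    refine Finset.sum_congr rfl fun j hj => ?_
    rw [map_mul, ← hQ j hj, ← mul_assoc, ← map_mul, mul_assoc (C (c j) * X),
      Finset.prod_sdiff (hST j hj), mul_comm (C (c j) * X), map_mul, mul_assoc]
    congr 1
    simp [Algebra.smul_def, mul_assoc, Algebra.commutes h]

/-- Under the DIRK hypotheses every `R^(k)` commutes with `L`,
`(∏_{j≤k}(I - h a_jj L)) R^(k)` is a polynomial in `hL` of degree ≤ k-1, and the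
amplification matrix is the rational matrix function `N(hL) D(hL)⁻¹` with
`D(z) = ∏ (1 - a_jj z)`. -/
theorem stmt_2 (N s : ℕ) (L : Matrix (Fin N) (Fin N) ℝ) (h : ℝ)
    (A : Matrix (Fin s) (Fin s) ℝ) (b : Fin s → ℝ)
    (hA : ∀ i j : Fin s, i < j → A i j = 0)
    (hinv : ∀ k : Fin s, IsUnit (1 - (h * A k k) • L))
    (R : Fin s → Matrix (Fin N) (Fin N) ℝ)
    (hR : ∀ k : Fin s,
      R k = (1 - (h * A k k) • L)⁻¹ *
        (1 + ∑ j ∈ Finset.Iio k, (h * A k j) • (L * R j))) :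
    (∀ k : Fin s, L * R k = R k * L) ∧
    (∀ k : Fin s, ∃ Nk : Polynomial ℝ, Nk.natDegree ≤ (k : ℕ) ∧
      Polynomial.aeval (h • L)
          (∏ j ∈ Finset.Iic k, (1 - Polynomial.C (A j j) * Polynomial.X)) * R k =
        Polynomial.aeval (h • L) Nk) ∧
    ∃ P : Polynomial ℝ,
      Polynomial.aeval (h • L)
          (∏ j : Fin s, (1 - Polynomial.C (A j j) * Polynomial.X)) *
        (1 + ∑ i : Fin s, (h * b i) • (L * R i)) = Polynomial.aeval (h • L) P ∧
      1 + ∑ i : Fin s, (h * b i) • (L * R i) =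
        Polynomial.aeval (h • L) P *
          (Polynomial.aeval (h • L)
            (∏ j : Fin s, (1 - Polynomial.C (A j j) * Polynomial.X)))⁻¹ := by
  open Polynomial in
  have hq : ∀ k : Fin s, aeval (h • L) (1 - C (A k k) * X) = 1 - (h * A k k) • L := fun k => by
    rw [map_sub, map_one, map_mul, aeval_C, aeval_X, ← Algebra.smul_def, smul_smul,
      mul_comm (A k k)]
  have hcomm : ∀ k : Fin s, Commute L (R k) := by
    intro k
    induction k using WellFoundedLT.induction with
    | ind k ih =>
      rw [hR k]
      refine Commute.mul_right ?_ ?_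
      · obtain ⟨u, hu⟩ := hinv k
        rw [← hu, ← Matrix.coe_units_inv]
        refine Commute.units_inv_right ?_
        rw [hu]
        exact (Commute.one_right L).sub_right ((Commute.refl L).smul_right _)
      · refine (Commute.one_right L).add_right (Commute.sum_right _ _ _ fun j hj => ?_)
        exact ((Commute.refl L).mul_right (ih j (Finset.mem_Iio.mp hj))).smul_right _
  have hpoly : ∀ k : Fin s, ∃ Nk : Polynomial ℝ, Nk.natDegree ≤ (k : ℕ) ∧
      Polynomial.aeval (h • L)
          (∏ j ∈ Finset.Iic k, (1 - Polynomial.C (A j j) * Polynomial.X)) * R k =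
        Polynomial.aeval (h • L) Nk := by
    intro k
    induction k using WellFoundedLT.induction with
    | ind k ih =>
      obtain ⟨P, hdeg, hP⟩ := exists_aeval_eq_prod_mul_stage_sum L h (fun j => A j j) (A k) R
        (Finset.Iio k) (Finset.Iio k)
        (fun j hj i hi => Finset.mem_Iio.mpr
          ((Finset.mem_Iic.mp hi).trans_lt (Finset.mem_Iio.mp hj)))
        (fun j hj => ih j (Finset.mem_Iio.mp hj))
      refine ⟨P, by simpa using hdeg, ?_⟩
      rw [← hP, ← Finset.Iio_insert, Finset.prod_insert (by simp), mul_comm, map_mul, hq,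
        mul_assoc]
      congr 1
      rw [hR k, Matrix.mul_nonsing_inv_cancel_left _ _ ((Matrix.isUnit_iff_isUnit_det _).mp
        (hinv k))]
  refine ⟨hcomm, hpoly, ?_⟩
  obtain ⟨P, -, hP⟩ := exists_aeval_eq_prod_mul_stage_sum L h (fun j => A j j) b R
    Finset.univ Finset.univ (fun j _ => Finset.subset_univ _) (fun j _ => hpoly j)
  refine ⟨P, hP, ?_⟩
  have hunit : IsUnit (Polynomial.aeval (h • L)
      (∏ j : Fin s, (1 - Polynomial.C (A j j) * Polynomial.X))) := by
    refine Finset.prod_induction _ (fun q => IsUnit (Polynomial.aeval (h • L) q))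
      (fun p q hp hq => by rw [map_mul]; exact hp.mul hq) (by simp) fun j _ => ?_
    exact (hq j).symm ▸ hinv j
  have hDP := (Commute.all (∏ j : Fin s, (1 - Polynomial.C (A j j) * Polynomial.X)) P).map
    (Polynomial.aeval (h • L))
  obtain ⟨u, hu⟩ := hunit
  rw [← hu] at hP hDP ⊢
  rw [← Matrix.coe_units_inv, ← hDP.units_inv_left.eq, ← hP, Units.inv_mul_cancel_left]
end

section
/- Let ω₁, α, κ, γ₁, β be real numbers and let y = (y₁, y₂, y₃, y₄) : ℝ → ℝ⁴ be a differentiable solution of y' = L(ω₁,γ₁,α,β,κ) y. Then the quadratic form Ẽ(t) = ½(y₂(t)² + κ y₄(t)² + ω₁² y₁(t)² + κα²ω₁²(y₁(t) − y₃(t))²) is differentiable with Ẽ'(t) = −γ₁ y₂(t)² − κβγ₁ y₄(t)² for all t. In particular Ẽ is constant along solutions when γ₁ = 0, and non-increasing when γ₁ ≥ 0, β ≥ 0, κ ≥ 0. -/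
/-- The 4×4 system matrix of the first-order form of the two coupled damped
oscillators. -/
def L4 (ω₁ γ₁ α β κ : ℝ) : Matrix (Fin 4) (Fin 4) ℝ :=
  !![0, 1, 0, 0;
     -ω₁ ^ 2 * (1 + α ^ 2 * κ), -γ₁, κ * α ^ 2 * ω₁ ^ 2, 0;
     0, 0, 0, 1;
     α ^ 2 * ω₁ ^ 2, 0, -α ^ 2 * ω₁ ^ 2, -β * γ₁]

/-- Along solutions of `y' = L(ω₁,γ₁,α,β,κ) y`, the quadratic
form `Ẽ = ½(y₂² + κy₄² + ω₁²y₁² + κα²ω₁²(y₁-y₃)²)` satisfies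
`Ẽ' = -γ₁y₂² - κβγ₁y₄²`; it is constant when `γ₁ = 0` and non-increasing when
`γ₁, β, κ ≥ 0`. -/
theorem stmt_10 (ω₁ γ₁ α β κ : ℝ) (y : ℝ → Fin 4 → ℝ)
    (hy : ∀ t, HasDerivAt y ((L4 ω₁ γ₁ α β κ).mulVec (y t)) t)
    (E : ℝ → ℝ)
    (hE : E = fun t => (y t 1 ^ 2 + κ * y t 3 ^ 2 + ω₁ ^ 2 * y t 0 ^ 2 +
      κ * α ^ 2 * ω₁ ^ 2 * (y t 0 - y t 2) ^ 2) / 2) :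
    (∀ t, HasDerivAt E (-(γ₁ * y t 1 ^ 2) - κ * β * γ₁ * y t 3 ^ 2) t) ∧
    (γ₁ = 0 → ∀ t t' : ℝ, E t = E t') ∧
    (0 ≤ γ₁ → 0 ≤ β → 0 ≤ κ → Antitone E) := by
  have hderiv : ∀ t, HasDerivAt E (-(γ₁ * y t 1 ^ 2) - κ * β * γ₁ * y t 3 ^ 2) t := by
    intro t
    have h := hasDerivAt_pi.1 (hy t)
    have h0 := h 0
    have h1 := h 1
    have h2 := h 2
    have h3 := h 3
    simp only [L4, Matrix.mulVec, dotProduct, Fin.sum_univ_four, Matrix.of_apply,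
      Matrix.cons_val] at h0 h1 h2 h3
    rw [hE]
    refine (((((h1.fun_pow 2).fun_add ((h3.fun_pow 2).const_mul κ)).fun_add
      ((h0.fun_pow 2).const_mul (ω₁ ^ 2))).fun_add
      (((h0.fun_sub h2).fun_pow 2).const_mul (κ * α ^ 2 * ω₁ ^ 2))).div_const 2).congr_deriv ?_
    push_cast
    ring
  have hdiff : Differentiable ℝ E := fun t => (hderiv t).differentiableAt
  refine ⟨hderiv, fun hγ => is_const_of_deriv_eq_zero hdiff fun t => ?_,
    fun hγ hβ hκ => antitone_of_deriv_nonpos hdiff fun t => ?_⟩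
  · rw [(hderiv t).deriv, hγ]
    ring
  · rw [(hderiv t).deriv]
    have h1 : 0 ≤ γ₁ * y t 1 ^ 2 := by positivity
    have h3 : 0 ≤ κ * β * γ₁ * y t 3 ^ 2 := by positivity
    linarith
end
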